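/- arXiv:2009.12326 — 2 statements merged into one kernel-verified Lean document; each statement's English description precedes it below -/
import Mathlib

section
/- Let p ≥ 1 and T ≥ 2 be integers, let M_1, …, M_T be symmetric positive definite p×p real matrices, and let γ_1, …, γ_{T-1} ∈ (0,1). Define functions Q_t on the set of symmetric positive definite p×p matrices recursively by Q_1(Σ) = −(log det Σ + tr(Σ⁻¹ M_1)) and Q_{t+1}(Σ) = (1−γ_t) Q_t(Σ) + γ_t · (−(log det Σ + tr(Σ⁻¹ M_{t+1}))). Then for every t ∈ {1, …, T} the function Q_t attains a unique maximum over the set of symmetric positive definite matrices at a point Σ^t, and these maximizers satisfy the recursion Σ^1 = M_1 and Σ^{t+1} = (1−γ_t) Σ^t + γ_t M_{t+1} for all t ∈ {1, …, T−1}. -/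
open Matrix

/-- The eigenvalues of a Hermitian matrix are all `1` only for the identity matrix. -/
theorem Matrix.IsHermitian.eq_one_of_eigenvalues {n : Type*} [Fintype n] [DecidableEq n]
    {P : Matrix n n ℝ} (hP : P.IsHermitian) (h : ∀ i, hP.eigenvalues i = 1) : P = 1 := by
  have hdiag : (diagonal (RCLike.ofReal ∘ hP.eigenvalues) : Matrix n n ℝ) = 1 := by
    rw [← diagonal_one]
    congr 1
    ext i
    simp [h i]
  rw [hP.spectral_theorem, hdiag, map_one]

theorem Matrix.PosDef.trace_sub_card_sub_log_det {n : Type*} [Fintype n] [DecidableEq n]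
    {P : Matrix n n ℝ} (hP : P.PosDef) :
    P.trace - Fintype.card n - Real.log P.det =
      ∑ i, (hP.1.eigenvalues i - 1 - Real.log (hP.1.eigenvalues i)) := by
  rw [hP.1.det_eq_prod_eigenvalues, hP.1.trace_eq_sum_eigenvalues]
  simp only [RCLike.ofReal_real_eq_id, id]
  rw [Real.log_prod fun i _ => (hP.eigenvalues_pos i).ne']
  simp

theorem Matrix.PosDef.log_det_le_trace_sub_card {n : Type*} [Fintype n] [DecidableEq n]
    {P : Matrix n n ℝ} (hP : P.PosDef) : Real.log P.det ≤ P.trace - Fintype.card n := by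
  rw [← sub_nonneg, hP.trace_sub_card_sub_log_det]
  exact Finset.sum_nonneg fun i _ =>
    sub_nonneg.2 (Real.log_le_sub_one_of_pos (hP.eigenvalues_pos i))

theorem Matrix.PosDef.eq_one_of_trace_sub_card_le_log_det {n : Type*} [Fintype n] [DecidableEq n]
    {P : Matrix n n ℝ} (hP : P.PosDef) (h : P.trace - Fintype.card n ≤ Real.log P.det) :
    P = 1 := by
  have hnonneg : ∀ i ∈ Finset.univ,
      0 ≤ hP.1.eigenvalues i - 1 - Real.log (hP.1.eigenvalues i) := fun i _ =>
    sub_nonneg.2 (Real.log_le_sub_one_of_pos (hP.eigenvalues_pos i))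
  have hsum := hP.trace_sub_card_sub_log_det
  have hzero := (Finset.sum_eq_zero_iff_of_nonneg hnonneg).1
    (le_antisymm (by linarith) (Finset.sum_nonneg hnonneg))
  refine hP.1.eq_one_of_eigenvalues fun i => ?_
  by_contra hi
  linarith [hzero i (Finset.mem_univ i), Real.log_lt_sub_one_of_pos (hP.eigenvalues_pos i) hi]

open scoped MatrixOrder Matrix.Norms.L2Operator in
/-- For positive definite `S` and `A`, the matrix `A⁻¹ * S` is similar to a positive definite
one, which is the identity only if `A = S`. -/
theorem Matrix.PosDef.exists_posDef_of_inv_mul {n : Type*} [Fintype n] [DecidableEq n]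
    {S A : Matrix n n ℝ} (hS : S.PosDef) (hA : A.PosDef) :
    ∃ P : Matrix n n ℝ, P.PosDef ∧ P.trace = (A⁻¹ * S).trace ∧
      Real.log P.det = Real.log S.det - Real.log A.det ∧ (P = 1 → A = S) := by
  obtain ⟨B, hB, rfl⟩ :=
    CStarAlgebra.isStrictlyPositive_iff_eq_star_mul_self.mp hS.isStrictlyPositive
  rw [star_eq_conjTranspose] at hS ⊢
  have hAdet : IsUnit A.det := (isUnit_iff_isUnit_det A).1 hA.isUnit
  refine ⟨B * A⁻¹ * Bᴴ, ?_, ?_, ?_, fun h => ?_⟩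
  · exact hA.inv.mul_mul_conjTranspose_same (vecMul_injective_of_isUnit hB)
  · rw [trace_mul_comm, ← mul_assoc, trace_mul_comm]
  · rw [← Real.log_div hS.det_pos.ne' hA.det_pos.ne']
    congr 1
    simp only [det_mul, det_nonsing_inv, Ring.inverse_eq_inv']
    ring
  · have hinv : A⁻¹ * (Bᴴ * B) = 1 := by
      rw [← mul_assoc]
      exact mul_eq_one_comm.1 (by rwa [← mul_assoc])
    calc A = A * (A⁻¹ * (Bᴴ * B)) := by rw [hinv, mul_one]
      _ = Bᴴ * B := mul_nonsing_inv_cancel_left A _ hAdet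

/-- The Gaussian negative log-likelihood with second-moment matrix `S` is minimal at
covariance `S`. -/
theorem Matrix.PosDef.log_det_add_trace_le {n : Type*} [Fintype n] [DecidableEq n]
    {S A : Matrix n n ℝ} (hS : S.PosDef) (hA : A.PosDef) :
    Real.log S.det + (S⁻¹ * S).trace ≤ Real.log A.det + (A⁻¹ * S).trace := by
  obtain ⟨P, hP, htr, hdet, -⟩ := hS.exists_posDef_of_inv_mul hA
  have hle := hP.log_det_le_trace_sub_card
  rw [nonsing_inv_mul _ ((isUnit_iff_isUnit_det S).1 hS.isUnit), trace_one]
  linarith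

theorem Matrix.PosDef.eq_of_log_det_add_trace_le {n : Type*} [Fintype n] [DecidableEq n]
    {S A : Matrix n n ℝ} (hS : S.PosDef) (hA : A.PosDef)
    (h : Real.log A.det + (A⁻¹ * S).trace ≤ Real.log S.det + (S⁻¹ * S).trace) : A = S := by
  obtain ⟨P, hP, htr, hdet, heq⟩ := hS.exists_posDef_of_inv_mul hA
  rw [nonsing_inv_mul _ ((isUnit_iff_isUnit_det S).1 hS.isUnit), trace_one] at h
  exact heq (hP.eq_one_of_trace_sub_card_le_log_det (by linarith))

/-- Online EM update rule (Lemma 1): the maximizers of the recursively updated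
objectives Q_t over symmetric positive definite matrices satisfy
Σ^1 = M_1 and Σ^{t+1} = (1−γ_t) Σ^t + γ_t M_{t+1}. -/
theorem stmt_0 (p T : ℕ) (hp : 1 ≤ p) (hT : 2 ≤ T)
    (M : ℕ → Matrix (Fin p) (Fin p) ℝ) (hM : ∀ t, 1 ≤ t → t ≤ T → (M t).PosDef)
    (γ : ℕ → ℝ) (hγ : ∀ t, 1 ≤ t → t ≤ T - 1 → γ t ∈ Set.Ioo (0:ℝ) 1)
    (Q : ℕ → Matrix (Fin p) (Fin p) ℝ → ℝ)
    (hQ1 : ∀ A : Matrix (Fin p) (Fin p) ℝ,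
      Q 1 A = -(Real.log A.det + (A⁻¹ * M 1).trace))
    (hQrec : ∀ t, 1 ≤ t → t ≤ T - 1 → ∀ A : Matrix (Fin p) (Fin p) ℝ,
      Q (t + 1) A = (1 - γ t) * Q t A
        + γ t * (-(Real.log A.det + (A⁻¹ * M (t + 1)).trace))) :
    ∃ S : ℕ → Matrix (Fin p) (Fin p) ℝ,
      (∀ t, 1 ≤ t → t ≤ T →
        (S t).PosDef ∧
        (∀ A : Matrix (Fin p) (Fin p) ℝ, A.PosDef → Q t A ≤ Q t (S t)) ∧
        (∀ A : Matrix (Fin p) (Fin p) ℝ, A.PosDef →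
          (∀ A' : Matrix (Fin p) (Fin p) ℝ, A'.PosDef → Q t A' ≤ Q t A) → A = S t)) ∧
      S 1 = M 1 ∧
      (∀ t, 1 ≤ t → t ≤ T - 1 → S (t + 1) = (1 - γ t) • S t + γ t • M (t + 1)) := by
  let S : ℕ → Matrix (Fin p) (Fin p) ℝ := fun t =>
    Nat.rec (M 1) (fun k X => (1 - γ (k + 1)) • X + γ (k + 1) • M (k + 2)) (t - 1)
  have hS1 : S 1 = M 1 := rfl
  have hSrec : ∀ t, 1 ≤ t → S (t + 1) = (1 - γ t) • S t + γ t • M (t + 1) := by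
    rintro (_ | k) hk
    · omega
    · rfl
  have hSQ : ∀ t, 1 ≤ t → t ≤ T → (S t).PosDef ∧
      ∀ A, Q t A = -(Real.log A.det + (A⁻¹ * S t).trace) := by
    intro t ht
    induction t, ht using Nat.le_induction with
    | base => exact fun h => ⟨hS1 ▸ hM 1 le_rfl h, hQ1⟩
    | succ t ht ih =>
      intro hle
      obtain ⟨hpos, hQ⟩ := ih (by omega)
      obtain ⟨hγ0, hγ1⟩ := hγ t ht (by omega)
      rw [hSrec t ht]
      refine ⟨(hpos.smul (sub_pos.2 hγ1)).add ((hM (t + 1) (by omega) hle).smul hγ0),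
        fun A => ?_⟩
      rw [hQrec t ht (by omega), hQ, mul_add, Matrix.mul_smul, Matrix.mul_smul, trace_add,
        trace_smul, trace_smul, smul_eq_mul, smul_eq_mul]
      ring
  refine ⟨S, fun t ht hle => ?_, hS1, fun t ht _ => hSrec t ht⟩
  obtain ⟨hpos, hQ⟩ := hSQ t ht hle
  simp only [hQ]
  exact ⟨hpos, fun A hA => neg_le_neg (hpos.log_det_add_trace_le hA), fun A hA hmax =>
    hpos.eq_of_log_det_add_trace_le hA (neg_le_neg_iff.1 (hmax _ hpos))⟩
end

section
/- Let S be a symmetric positive semidefinite p×p real matrix. Then the function Σ ↦ tr(Σ⁻¹ S) is convex on the set of symmetric positive definite p×p real matrices: for all symmetric positive definite A, B and all t ∈ [0,1], tr((t·A + (1−t)·B)⁻¹ S) ≤ t·tr(A⁻¹ S) + (1−t)·tr(B⁻¹ S). -/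
theorem Matrix.PosSemidef.trace_mul_nonneg {n : Type*} [Fintype n]
    {P S : Matrix n n ℝ} (hP : P.PosSemidef) (hS : S.PosSemidef) : 0 ≤ (P * S).trace := by
  obtain ⟨m, v, rfl⟩ := Matrix.posSemidef_iff_eq_sum_vecMulVec.mp hS
  rw [Matrix.mul_sum, Matrix.trace_sum]
  refine Finset.sum_nonneg fun i _ => ?_
  rw [Matrix.mul_vecMulVec, Matrix.trace_vecMulVec, dotProduct_comm]
  exact hP.dotProduct_mulVec_nonneg _

theorem Matrix.PosDef.convex_combination {n : Type*} {A B : Matrix n n ℝ}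
    (hA : A.PosDef) (hB : B.PosDef) {t : ℝ} (ht : t ∈ Set.Icc (0 : ℝ) 1) :
    (t • A + (1 - t) • B).PosDef := by
  rcases ht.1.eq_or_lt with rfl | h0
  · simpa using hB
  · exact (hA.smul h0).add_posSemidef (hB.posSemidef.smul (sub_nonneg.2 ht.2))

theorem Matrix.PosDef.inv_sub_mul_mul_inv_sub {n : Type*} [Fintype n] [DecidableEq n]
    {A : Matrix n n ℝ} (hA : A.PosDef) (N : Matrix n n ℝ) :
    (A⁻¹ - N) * A * (A⁻¹ - N) = A⁻¹ - (2 : ℝ) • N + N * A * N := by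
  have hu : IsUnit A.det := (Matrix.isUnit_iff_isUnit_det A).1 hA.isUnit
  rw [sub_mul, Matrix.nonsing_inv_mul A hu, sub_mul, one_mul, mul_sub, mul_assoc N A A⁻¹,
    Matrix.mul_nonsing_inv A hu, mul_one, two_smul]
  abel

/-- The matrix inverse is operator convex on positive definite matrices. -/
theorem Matrix.PosDef.posSemidef_convex_combination_inv_sub {n : Type*} [Fintype n]
    [DecidableEq n] {A B : Matrix n n ℝ} (hA : A.PosDef) (hB : B.PosDef) {t : ℝ}
    (ht : t ∈ Set.Icc (0 : ℝ) 1) :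
    (t • A⁻¹ + (1 - t) • B⁻¹ - (t • A + (1 - t) • B)⁻¹).PosSemidef := by
  have hM := hA.convex_combination hB ht
  set M := t • A + (1 - t) • B with hMdef
  have hNMN : M⁻¹ * M * M⁻¹ = M⁻¹ := by
    rw [Matrix.nonsing_inv_mul M ((Matrix.isUnit_iff_isUnit_det M).1 hM.isUnit), one_mul]
  have conj {C : Matrix n n ℝ} (hC : C.PosDef) :
      (C⁻¹ - (2 : ℝ) • M⁻¹ + M⁻¹ * C * M⁻¹).PosSemidef := by
    rw [← hC.inv_sub_mul_mul_inv_sub]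
    have h := hC.posSemidef.conjTranspose_mul_mul_same (C⁻¹ - M⁻¹)
    rwa [(hC.inv.isHermitian.sub hM.inv.isHermitian).eq] at h
  convert ((conj hA).smul ht.1).add ((conj hB).smul (sub_nonneg.2 ht.2)) using 1
  have hsplit : t • (M⁻¹ * A * M⁻¹) + (1 - t) • (M⁻¹ * B * M⁻¹) = M⁻¹ := by
    calc
      _ = M⁻¹ * M * M⁻¹ := by
        simp only [hMdef, mul_add, add_mul, Matrix.mul_smul, Matrix.smul_mul]
      _ = M⁻¹ := hNMN
  linear_combination (norm := module) -hsplit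

/-- Let S be a symmetric positive semidefinite p×p real matrix. Then the function
Σ ↦ tr(Σ⁻¹ S) is convex on the set of symmetric positive definite p×p real matrices. -/
theorem stmt_6 (p : ℕ) (S : Matrix (Fin p) (Fin p) ℝ) (hS : S.PosSemidef)
    (A B : Matrix (Fin p) (Fin p) ℝ) (hA : A.PosDef) (hB : B.PosDef)
    (t : ℝ) (ht : t ∈ Set.Icc (0:ℝ) 1) :
    ((t • A + (1 - t) • B)⁻¹ * S).trace ≤ t * (A⁻¹ * S).trace + (1 - t) * (B⁻¹ * S).trace := by
  have h := (hA.posSemidef_convex_combination_inv_sub hB ht).trace_mul_nonneg hS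
  simp only [sub_mul, add_mul, Matrix.smul_mul, Matrix.trace_sub, Matrix.trace_add,
    Matrix.trace_smul, smul_eq_mul] at h
  linarith
end
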